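/- arXiv:2308.02278 — 9 statements merged into one kernel-verified Lean document; each statement's English description precedes it below -/
import Mathlib

section
/- Suppose the SNL problem is generated by a framework with sensor positions s_1,…,s_n ∈ ℝ^d and anchor positions a_1,…,a_m ∈ ℝ^d, i.e., d_{ij} = ‖s_i − s_j‖ for every {i,j} ∈ N_x and d̃_{ij} = ‖a_i − s_j‖ for every (i,j) ∈ N_a. If 2·Σ_{{i,j}∈N_x} d_{ij}^{bc} > Σ_{(i,j)∈N_a} | ‖a_i + s_j‖^b − d̃_{ij}^b |^c, then the loss function loss : (ℝ^d)^n → ℝ is not convex. (In fact, midpoint convexity fails for the three points s, 0, and −s: 2·loss(0) > loss(s) + loss(−s).) -/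
/-- The SNL loss function with inside degree `b` and outside degree `c`. -/
noncomputable def snlLoss {d n m : ℕ}
    (Nx : Finset (Fin n × Fin n)) (Na : Finset (Fin m × Fin n))
    (a : Fin m → EuclideanSpace ℝ (Fin d))
    (dd : Fin n × Fin n → ℝ) (dt : Fin m × Fin n → ℝ) (b c : ℝ)
    (x : Fin n → EuclideanSpace ℝ (Fin d)) : ℝ :=
  ∑ p ∈ Nx, |‖x p.1 - x p.2‖ ^ b - dd p ^ b| ^ c
    + ∑ p ∈ Na, |‖a p.1 - x p.2‖ ^ b - dt p ^ b| ^ c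

/-- The loss vanishes at the generating positions. -/
theorem snlLoss_self {d n m : ℕ}
    (Nx : Finset (Fin n × Fin n)) (Na : Finset (Fin m × Fin n))
    (a : Fin m → EuclideanSpace ℝ (Fin d)) (s : Fin n → EuclideanSpace ℝ (Fin d))
    (b : ℝ) {c : ℝ} (hc : c ≠ 0) :
    snlLoss Nx Na a (fun p => ‖s p.1 - s p.2‖) (fun p => ‖a p.1 - s p.2‖) b c s = 0 := by
  simp [snlLoss, Real.zero_rpow hc]

/-- At the reflected positions only the anchor–sensor terms contribute. -/
theorem snlLoss_neg {d n m : ℕ}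
    (Nx : Finset (Fin n × Fin n)) (Na : Finset (Fin m × Fin n))
    (a : Fin m → EuclideanSpace ℝ (Fin d)) (s : Fin n → EuclideanSpace ℝ (Fin d))
    (b : ℝ) {c : ℝ} (hc : c ≠ 0) :
    snlLoss Nx Na a (fun p => ‖s p.1 - s p.2‖) (fun p => ‖a p.1 - s p.2‖) b c (-s)
      = ∑ p ∈ Na, |‖a p.1 + s p.2‖ ^ b - ‖a p.1 - s p.2‖ ^ b| ^ c := by
  have h (i j : Fin n) : ‖-s i + s j‖ = ‖s i - s j‖ := by
    rw [neg_add_eq_sub, norm_sub_rev]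
  simp [snlLoss, h, Real.zero_rpow hc]

/-- At the origin the loss is at least the contribution of the sensor–sensor terms. -/
theorem sum_rpow_le_snlLoss_zero {d n m : ℕ}
    (Nx : Finset (Fin n × Fin n)) (Na : Finset (Fin m × Fin n))
    (a : Fin m → EuclideanSpace ℝ (Fin d)) (dd : Fin n × Fin n → ℝ) (dt : Fin m × Fin n → ℝ)
    (hdd : ∀ p, 0 ≤ dd p) {b : ℝ} (hb : b ≠ 0) (c : ℝ) :
    ∑ p ∈ Nx, dd p ^ (b * c) ≤ snlLoss Nx Na a dd dt b c 0 := by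
  have h (p : Fin n × Fin n) : |dd p ^ b| ^ c = dd p ^ (b * c) := by
    rw [abs_of_nonneg (Real.rpow_nonneg (hdd p) b), Real.rpow_mul (hdd p)]
  simp only [snlLoss, Pi.zero_apply, sub_zero, norm_zero, Real.zero_rpow hb, zero_sub, abs_neg, h]
  exact le_add_of_nonneg_right (Finset.sum_nonneg fun p _ => by positivity)

/-- A function that violates midpoint convexity at `x`, `0`, `-x` is not convex. -/
theorem not_convexOn_of_add_neg_lt {E : Type*} [AddCommGroup E] [Module ℝ E] {f : E → ℝ} {x : E}
    (h : f x + f (-x) < 2 * f 0) : ¬ ConvexOn ℝ Set.univ f := by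
  intro hf
  have := hf.2 (Set.mem_univ x) (Set.mem_univ (-x)) one_half_pos.le one_half_pos.le
    (add_halves 1)
  rw [smul_neg, add_neg_cancel, smul_eq_mul, smul_eq_mul] at this
  linarith

/-- If the SNL problem is generated by a framework `(a, s)` and
`2 ∑_{Nx} d_{ij}^{bc} > ∑_{Na} |‖a_i + s_j‖^b − d̃_{ij}^b|^c`, then the loss function is
not convex; in fact midpoint convexity fails for the points `s`, `0`, `−s`. -/
theorem stmt0 {d n m : ℕ} (hd : 1 ≤ d) (hn : 1 ≤ n) (hm : 1 ≤ m)
    (Nx : Finset (Fin n × Fin n)) (hNx : ∀ p ∈ Nx, p.1 < p.2)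
    (Na : Finset (Fin m × Fin n))
    (a : Fin m → EuclideanSpace ℝ (Fin d)) (s : Fin n → EuclideanSpace ℝ (Fin d))
    (b c : ℝ) (hb : 0 < b) (hc : 0 < c)
    (hkey : 2 * ∑ p ∈ Nx, ‖s p.1 - s p.2‖ ^ (b * c)
        > ∑ p ∈ Na, |‖a p.1 + s p.2‖ ^ b - ‖a p.1 - s p.2‖ ^ b| ^ c) :
    ¬ ConvexOn ℝ Set.univ
        (snlLoss Nx Na a (fun p => ‖s p.1 - s p.2‖) (fun p => ‖a p.1 - s p.2‖) b c)
    ∧ 2 * snlLoss Nx Na a (fun p => ‖s p.1 - s p.2‖) (fun p => ‖a p.1 - s p.2‖) b c 0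
        > snlLoss Nx Na a (fun p => ‖s p.1 - s p.2‖) (fun p => ‖a p.1 - s p.2‖) b c s
          + snlLoss Nx Na a (fun p => ‖s p.1 - s p.2‖) (fun p => ‖a p.1 - s p.2‖) b c (-s) := by
  have hmid : snlLoss Nx Na a (fun p => ‖s p.1 - s p.2‖) (fun p => ‖a p.1 - s p.2‖) b c s
      + snlLoss Nx Na a (fun p => ‖s p.1 - s p.2‖) (fun p => ‖a p.1 - s p.2‖) b c (-s)
      < 2 * snlLoss Nx Na a (fun p => ‖s p.1 - s p.2‖) (fun p => ‖a p.1 - s p.2‖) b c 0 := by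
    rw [snlLoss_self Nx Na a s b hc.ne', snlLoss_neg Nx Na a s b hc.ne']
    have := sum_rpow_le_snlLoss_zero Nx Na a (fun p => ‖s p.1 - s p.2‖)
      (fun p => ‖a p.1 - s p.2‖) (fun _ => norm_nonneg _) hb.ne' c
    linarith
  exact ⟨not_convexOn_of_add_neg_lt hmid, hmid⟩
end

section
/- Consider the unit-disk SNL case (U, r, n, a) with exponents b, c > 0, and assume there exist ε ∈ (0,1) and p_r ∈ (0,1] such that for every x ∈ U the probability that an independent uniform random point s′ of U satisfies εr ≤ ‖x − s′‖ ≤ r is at least p_r. Then, writing v = ⌊√n⌋, there exists N ∈ ℕ such that for every number of sensors n > N, the probability that the random loss function loss : (ℝ^d)^n → ℝ is not convex is at least 1 − n·v·C(n−1, v−1)·(1−p_r)^{n−v}. In particular, for every p₀ < 1 there exists N ∈ ℕ such that for all n > N this probability exceeds p₀. -/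
open MeasureTheory
open scoped Classical

/-- The uniform probability measure on a region `U` of Euclidean space. -/
noncomputable def unifMeasure {d : ℕ} (U : Set (EuclideanSpace ℝ (Fin d))) :
    Measure (EuclideanSpace ℝ (Fin d)) :=
  (volume U)⁻¹ • volume.restrict U

/-- The random loss function of the unit-disk SNL case: given sensor positions `S`,
the edges are the pairs at distance at most `r`, with distances given by the framework. -/
noncomputable def udLoss {d m : ℕ} (a : Fin m → EuclideanSpace ℝ (Fin d)) (r b c : ℝ)
    {n : ℕ} (S : Fin n → EuclideanSpace ℝ (Fin d))
    (x : Fin n → EuclideanSpace ℝ (Fin d)) : ℝ :=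
  ∑ p ∈ Finset.univ.filter
      (fun p : Fin n × Fin n => p.1 < p.2 ∧ dist (S p.1) (S p.2) ≤ r),
      |‖x p.1 - x p.2‖ ^ b - dist (S p.1) (S p.2) ^ b| ^ c
    + ∑ p ∈ Finset.univ.filter
      (fun p : Fin m × Fin n => dist (a p.1) (S p.2) ≤ r),
      |‖a p.1 - x p.2‖ ^ b - dist (a p.1) (S p.2) ^ b| ^ c

lemma udLoss_self {d m n : ℕ} (a : Fin m → EuclideanSpace ℝ (Fin d)) {r b c : ℝ} (hc : 0 < c)
    (S : Fin n → EuclideanSpace ℝ (Fin d)) : udLoss a r b c S S = 0 := by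
  simp [udLoss, dist_eq_norm, Real.zero_rpow hc.ne']

/-- Reflecting the framework through the origin only costs anchor terms. -/
lemma udLoss_neg_le {d m n : ℕ} (a : Fin m → EuclideanSpace ℝ (Fin d)) {r b c R : ℝ}
    (hb : 0 < b) (hc : 0 < c) (hR : 0 ≤ R)
    (S : Fin n → EuclideanSpace ℝ (Fin d)) (ha : ∀ i, ‖a i‖ ≤ R) (hS : ∀ j, ‖S j‖ ≤ R) :
    udLoss a r b c S (-S) ≤ m * n * ((2 * R) ^ b) ^ c := by
  have hedge : ∀ i j, ‖(-S) i - (-S) j‖ = dist (S i) (S j) := fun i j => by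
    rw [dist_comm, dist_eq_norm, Pi.neg_apply, Pi.neg_apply]
    congr 1
    abel
  have hterm : ∀ p : Fin m × Fin n,
      |‖a p.1 - (-S) p.2‖ ^ b - dist (a p.1) (S p.2) ^ b| ^ c ≤ ((2 * R) ^ b) ^ c := fun p => by
    have hplus : ‖a p.1 - (-S) p.2‖ ≤ 2 * R :=
      (norm_sub_le _ _).trans (by
        rw [Pi.neg_apply, norm_neg]; linarith [ha p.1, hS p.2])
    have hminus : dist (a p.1) (S p.2) ≤ 2 * R := by
      rw [dist_eq_norm]
      exact (norm_sub_le _ _).trans (by linarith [ha p.1, hS p.2])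
    have hplus' := Real.rpow_le_rpow (norm_nonneg _) hplus hb.le
    have hminus' := Real.rpow_le_rpow dist_nonneg hminus hb.le
    have hplus0 := Real.rpow_nonneg (norm_nonneg (a p.1 - (-S) p.2)) b
    have hminus0 := Real.rpow_nonneg (dist_nonneg (x := a p.1) (y := S p.2)) b
    exact Real.rpow_le_rpow (abs_nonneg _) (abs_le.2 ⟨by linarith, by linarith⟩) hc.le
  have hC : 0 ≤ ((2 * R) ^ b) ^ c := by positivity
  simp only [udLoss, hedge, sub_self, abs_zero, Real.zero_rpow hc.ne', Finset.sum_const_zero,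
    zero_add]
  refine (Finset.sum_le_card_nsmul _ _ _ fun p _ => hterm p).trans ?_
  rw [nsmul_eq_mul]
  refine mul_le_mul_of_nonneg_right ?_ hC
  exact_mod_cast (Finset.card_le_univ _).trans_eq (by simp)

/-- Collapsing all sensors to the origin costs the full length of every edge. -/
lemma le_udLoss_zero {d m n v : ℕ} (a : Fin m → EuclideanSpace ℝ (Fin d)) {r b c ρ : ℝ}
    (hb : 0 < b) (hc : 0 < c) (hρ : 0 < ρ) (S : Fin n → EuclideanSpace ℝ (Fin d))
    (hdeg : ∀ i, v ≤ (Finset.univ.filter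
      fun j => ρ ≤ dist (S i) (S j) ∧ dist (S i) (S j) ≤ r).card) :
    n * v * (ρ ^ b) ^ c ≤ 2 * udLoss a r b c S 0 := by
  set A : Finset (Fin n × Fin n) := Finset.univ.filter
    fun p => ρ ≤ dist (S p.1) (S p.2) ∧ dist (S p.1) (S p.2) ≤ r with hA
  set P : Finset (Fin n × Fin n) := Finset.univ.filter
    fun p => p.1 < p.2 ∧ (ρ ≤ dist (S p.1) (S p.2) ∧ dist (S p.1) (S p.2) ≤ r) with hP
  have hcardA : n * v ≤ A.card := by
    have hsum : A.card = ∑ i : Fin n, (Finset.univ.filter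
        fun j => ρ ≤ dist (S i) (S j) ∧ dist (S i) (S j) ≤ r).card := by
      simp only [hA, Finset.card_filter, Fintype.sum_prod_type]
    rw [hsum]
    calc n * v = ∑ _i : Fin n, v := by simp
      _ ≤ _ := Finset.sum_le_sum fun i _ => hdeg i
  have hcardP : A.card ≤ 2 * P.card := by
    have hsub : A ⊆ P ∪ P.image Prod.swap := by
      rintro ⟨i, j⟩ hp
      simp only [hA, Finset.mem_filter, Finset.mem_univ, true_and] at hp
      simp only [hP, Finset.mem_union, Finset.mem_image, Finset.mem_filter, Finset.mem_univ,
        true_and, Prod.exists, Prod.swap_prod_mk, Prod.mk.injEq]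
      rcases lt_trichotomy i j with h | h | h
      · exact Or.inl ⟨h, hp⟩
      · subst h
        rw [dist_self] at hp
        exact absurd hp.1 (not_le.2 hρ)
      · rw [dist_comm] at hp
        exact Or.inr ⟨j, i, ⟨h, hp⟩, rfl, rfl⟩
    have hswap : (P.image Prod.swap).card ≤ P.card := Finset.card_image_le
    have := (Finset.card_le_card hsub).trans (Finset.card_union_le _ _)
    omega
  have hloss : P.card * (ρ ^ b) ^ c ≤ udLoss a r b c S 0 := by
    have hedges : (P.card : ℝ) * (ρ ^ b) ^ c ≤ ∑ p ∈ Finset.univ.filter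
        (fun p : Fin n × Fin n => p.1 < p.2 ∧ dist (S p.1) (S p.2) ≤ r),
        |‖(0 : Fin n → EuclideanSpace ℝ (Fin d)) p.1
          - (0 : Fin n → EuclideanSpace ℝ (Fin d)) p.2‖ ^ b - dist (S p.1) (S p.2) ^ b| ^ c := by
      rw [← nsmul_eq_mul]
      refine (Finset.card_nsmul_le_sum P _ _ fun p hp => ?_).trans
        (Finset.sum_le_sum_of_subset_of_nonneg ?_ fun p _ _ => Real.rpow_nonneg (abs_nonneg _) _)
      · simp only [hP, Finset.mem_filter, Finset.mem_univ, true_and] at hp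
        simp only [Pi.zero_apply, sub_self, norm_zero, Real.zero_rpow hb.ne', zero_sub, abs_neg]
        rw [abs_of_nonneg (Real.rpow_nonneg dist_nonneg _)]
        exact Real.rpow_le_rpow (by positivity) (Real.rpow_le_rpow hρ.le hp.2.1 hb.le) hc.le
      · intro p hp
        simp only [hP, Finset.mem_filter, Finset.mem_univ, true_and] at hp ⊢
        exact ⟨hp.1, hp.2.2⟩
    refine hedges.trans (le_add_of_nonneg_right ?_)
    exact Finset.sum_nonneg fun p _ => Real.rpow_nonneg (abs_nonneg _) _
  have hcard : (n : ℝ) * v ≤ 2 * P.card := by exact_mod_cast hcardA.trans hcardP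
  have hK : 0 ≤ (ρ ^ b) ^ c := by positivity
  nlinarith

/-- If every sensor has many long edges compared with the number of anchors, the loss is not
convex: otherwise its value at the collapsed framework would be at most the average of its
values at the true framework and at the reflected one. -/
lemma not_convexOn_udLoss {d m n v : ℕ} (a : Fin m → EuclideanSpace ℝ (Fin d))
    {r b c ρ R : ℝ} (hb : 0 < b) (hc : 0 < c) (hρ : 0 < ρ) (hR : 0 ≤ R) (hn : 0 < n)
    (S : Fin n → EuclideanSpace ℝ (Fin d)) (ha : ∀ i, ‖a i‖ ≤ R) (hS : ∀ j, ‖S j‖ ≤ R)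
    (hdeg : ∀ i, v ≤ (Finset.univ.filter
      fun j => ρ ≤ dist (S i) (S j) ∧ dist (S i) (S j) ≤ r).card)
    (hv : m * ((2 * R) ^ b) ^ c < v * (ρ ^ b) ^ c) :
    ¬ ConvexOn ℝ Set.univ (udLoss a r b c S) := by
  intro hconv
  have hmid := hconv.2 (Set.mem_univ S) (Set.mem_univ (-S)) (by norm_num : (0 : ℝ) ≤ 1 / 2)
    (by norm_num : (0 : ℝ) ≤ 1 / 2) (by norm_num)
  rw [← smul_add, add_neg_cancel, smul_zero, udLoss_self a hc, smul_zero, zero_add,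
    smul_eq_mul] at hmid
  have hupper := udLoss_neg_le (r := r) a hb hc hR S ha hS
  have hlower := le_udLoss_zero (c := c) a hb hc hρ S hdeg
  have hn' : (0 : ℝ) < n := by exact_mod_cast hn
  nlinarith [mul_lt_mul_of_pos_left hv hn']

/-- Union bound for the number of random points related to a given one. -/
lemma measure_pi_card_le {E : Type*} [MeasurableSpace E] (μ : Measure E)
    [IsProbabilityMeasure μ] {Rel : E → E → Prop} [∀ x, DecidablePred (Rel x)]
    (hRel : MeasurableSet {p : E × E | Rel p.1 p.2})
    {U : Set E} (hU : MeasurableSet U) {q : ENNReal} (hq : ∀ x ∈ U, μ {y | ¬ Rel x y} ≤ q)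
    {k s : ℕ} (hs : s ≤ k) (i : Fin (k + 1)) :
    Measure.pi (fun _ : Fin (k + 1) => μ)
      {S | S i ∈ U ∧ (Finset.univ.filter fun j => Rel (S i) (S (i.succAbove j))).card ≤ s} ≤
      k.choose s * q ^ (k - s) := by
  set B : Finset (Fin k) → Set (E × (Fin k → E)) :=
    fun T => {z | z.1 ∈ U ∧ ∀ j ∉ T, ¬ Rel z.1 (z.2 j)} with hB
  have hBmeas : ∀ T, MeasurableSet (B T) := fun T => by
    refine (measurable_fst hU).inter ?_
    have : {z : E × (Fin k → E) | ∀ j ∉ T, ¬ Rel z.1 (z.2 j)} =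
        ⋂ j, ⋂ (_ : j ∉ T), (fun z : E × (Fin k → E) => (z.1, z.2 j)) ⁻¹'
          {p : E × E | Rel p.1 p.2}ᶜ := by
      ext z
      simp
    change MeasurableSet {z : E × (Fin k → E) | ∀ j ∉ T, ¬ Rel z.1 (z.2 j)}
    rw [this]
    refine MeasurableSet.iInter fun j => MeasurableSet.iInter fun _ => ?_
    exact (by fun_prop : Measurable fun z : E × (Fin k → E) => (z.1, z.2 j)) hRel.compl
  have hBbound : ∀ T : Finset (Fin k), T.card = s →
      (μ.prod (Measure.pi fun _ : Fin k => μ)) (B T) ≤ q ^ (k - s) := fun T hT => by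
    rw [Measure.prod_apply (hBmeas T)]
    have hslice : ∀ x, (Measure.pi fun _ : Fin k => μ) (Prod.mk x ⁻¹' B T) ≤ q ^ (k - s) := by
      intro x
      by_cases hx : x ∈ U
      · have hpi : Prod.mk x ⁻¹' B T =
            Set.univ.pi fun j => if j ∈ T then Set.univ else {y | ¬ Rel x y} := by
          ext S
          simp only [hB, Set.mem_preimage, Set.mem_ofPred_eq, hx, true_and, Set.mem_pi,
            Set.mem_univ, true_implies]
          refine forall_congr' fun j => ?_
          by_cases hj : j ∈ T <;> simp [hj]
        rw [hpi, Measure.pi_pi]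
        calc ∏ j, μ (if j ∈ T then Set.univ else {y | ¬ Rel x y})
            ≤ ∏ j, (if j ∈ T then 1 else q) := Finset.prod_le_prod' fun j _ => by
              split_ifs
              · simp
              · exact hq x hx
          _ = q ^ (k - s) := by
              rw [Finset.prod_ite, Finset.prod_const_one, one_mul, Finset.prod_const]
              congr 1
              rw [Finset.filter_not, Finset.filter_mem_eq_inter, Finset.univ_inter,
                ← Finset.compl_eq_univ_sdiff, Finset.card_compl, hT, Fintype.card_fin]
      · have : Prod.mk x ⁻¹' B T = ∅ := by
          ext S
          simp [hB, hx]
        simp [this]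
    calc _ ≤ ∫⁻ _, q ^ (k - s) ∂μ := lintegral_mono hslice
      _ = _ := by simp
  have hmp := measurePreserving_piFinSuccAbove (fun _ : Fin (k + 1) => μ) i
  have hsub : {S : Fin (k + 1) → E | S i ∈ U ∧
        (Finset.univ.filter fun j => Rel (S i) (S (i.succAbove j))).card ≤ s} ⊆
      ⋃ T ∈ Finset.powersetCard s (Finset.univ : Finset (Fin k)),
        (MeasurableEquiv.piFinSuccAbove (fun _ : Fin (k + 1) => E) i) ⁻¹' B T := by
    rintro S ⟨hSi, hcard⟩
    obtain ⟨T, hTsub, -, hT⟩ := Finset.exists_subsuperset_card_eq (Finset.subset_univ _) hcard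
      (by simpa using hs)
    simp only [Set.mem_iUnion]
    refine ⟨T, by simp [Finset.mem_powersetCard, hT], hSi, fun j hj hrel => hj (hTsub ?_)⟩
    exact Finset.mem_filter.2 ⟨Finset.mem_univ _, hrel⟩
  calc _ ≤ ∑ T ∈ Finset.powersetCard s (Finset.univ : Finset (Fin k)),
        Measure.pi (fun _ : Fin (k + 1) => μ)
          ((MeasurableEquiv.piFinSuccAbove (fun _ : Fin (k + 1) => E) i) ⁻¹' B T) :=
        (measure_mono hsub).trans (measure_biUnion_finset_le _ _)
    _ ≤ ∑ _T ∈ Finset.powersetCard s (Finset.univ : Finset (Fin k)), q ^ (k - s) :=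
        Finset.sum_le_sum fun T hT => by
          rw [hmp.measure_preimage (hBmeas T).nullMeasurableSet]
          exact hBbound T (Finset.mem_powersetCard.1 hT).2
    _ = _ := by simp

lemma isProbabilityMeasure_unifMeasure {d : ℕ} {U : Set (EuclideanSpace ℝ (Fin d))}
    (hUne : U.Nonempty) (hUb : Bornology.IsBounded U) (hUopen : IsOpen U) :
    IsProbabilityMeasure (unifMeasure U) := by
  constructor
  rw [unifMeasure, Measure.smul_apply, Measure.restrict_apply_univ, smul_eq_mul]
  exact ENNReal.inv_mul_cancel (hUopen.measure_pos volume hUne).ne' hUb.measure_lt_top.ne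

lemma ae_mem_unifMeasure {d : ℕ} {U : Set (EuclideanSpace ℝ (Fin d))} (hUopen : IsOpen U) :
    ∀ᵐ x ∂unifMeasure U, x ∈ U :=
  Measure.smul_absolutelyContinuous.ae_le (ae_restrict_mem hUopen.measurableSet)

/-- The failure probability vanishes as the number of sensors grows. -/
lemma tendsto_sqrt_choose_mul_pow {q : ℝ} (hq0 : 0 ≤ q) (hq1 : q < 1) :
    Filter.Tendsto (fun n : ℕ => (n : ℝ) * (Nat.sqrt n : ℝ)
      * ((n - 1).choose (Nat.sqrt n - 1) : ℝ) * q ^ (n - Nat.sqrt n))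
      Filter.atTop (nhds 0) := by
  have hsqrt : Filter.Tendsto Nat.sqrt Filter.atTop Filter.atTop :=
    Filter.tendsto_atTop.2 fun k => by
      filter_upwards [Filter.eventually_ge_atTop (k * k)] with n hn using Nat.le_sqrt.2 hn
  have hbase : Filter.Tendsto (fun v : ℕ => ((v : ℝ) + 1) ^ 2 * q ^ (v - 3))
      Filter.atTop (nhds 0) := by
    rw [← Filter.tendsto_add_atTop_iff_nat 3]
    have h : ∀ k : ℕ, Filter.Tendsto (fun v : ℕ => (v : ℝ) ^ k * q ^ v)
        Filter.atTop (nhds 0) := fun k =>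
      tendsto_pow_const_mul_const_pow_of_abs_lt_one k (by rwa [abs_of_nonneg hq0])
    have := ((h 2).add ((h 1).const_mul 8)).add ((h 0).const_mul 16)
    simp only [mul_zero, add_zero] at this
    refine this.congr fun v => ?_
    push_cast
    ring
  refine squeeze_zero' (Filter.Eventually.of_forall fun n => by positivity) ?_
    (hbase.comp hsqrt)
  filter_upwards [hsqrt.eventually (Filter.eventually_ge_atTop 3),
    hsqrt.eventually (hbase.eventually_le_const one_pos)] with n hv hle
  simp only [Function.comp_apply]
  set v := Nat.sqrt n
  have hvn : v * v ≤ n := Nat.sqrt_le n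
  have hnv : n ≤ (v + 1) ^ 2 := by
    have := Nat.sqrt_lt'.1 (Nat.lt_succ_self v)
    exact this.le
  obtain ⟨w, hw⟩ : ∃ w, v = w + 3 := ⟨v - 3, by omega⟩
  have hcoef : n * v * (n - 1).choose (v - 1) ≤ ((v + 1) ^ 2) ^ (v + 2) := by
    calc n * v * (n - 1).choose (v - 1) ≤ n * n * n ^ (v - 1) := by
          gcongr
          · exact Nat.sqrt_le_self n
          · exact (Nat.choose_le_pow _ _).trans (Nat.pow_le_pow_left (Nat.sub_le _ _) _)
      _ = n ^ (v + 1) := by rw [hw]; simp only [Nat.add_succ_sub_one]; ring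
      _ ≤ ((v + 1) ^ 2) ^ (v + 1) := Nat.pow_le_pow_left hnv _
      _ ≤ _ := Nat.pow_le_pow_right (by positivity) (by omega)
  have hexp : (v - 3) * (v + 2) ≤ n - v := by
    rw [hw] at hvn ⊢
    rw [Nat.add_sub_cancel]
    exact Nat.le_sub_of_add_le (by nlinarith)
  have hcoef' : (n : ℝ) * v * ((n - 1).choose (v - 1) : ℝ) ≤ (((v : ℝ) + 1) ^ 2) ^ (v + 2) := by
    exact_mod_cast hcoef
  calc (n : ℝ) * v * ((n - 1).choose (v - 1) : ℝ) * q ^ (n - v)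
      ≤ (((v : ℝ) + 1) ^ 2) ^ (v + 2) * q ^ ((v - 3) * (v + 2)) :=
        mul_le_mul hcoef' (pow_le_pow_of_le_one hq0 hq1.le hexp) (by positivity) (by positivity)
    _ = (((v : ℝ) + 1) ^ 2 * q ^ (v - 3)) ^ (v + 2) := by rw [mul_pow, ← pow_mul q]
    _ ≤ ((v : ℝ) + 1) ^ 2 * q ^ (v - 3) := pow_le_of_le_one (by positivity) hle (by omega)

/-- In the unit-disk SNL case, with high probability (at least
`1 − n·v·C(n−1,v−1)·(1−p_r)^{n−v}`, where `v = ⌊√n⌋`) the loss function is not convex;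
in particular for every `p₀ < 1` the probability of non-convexity eventually exceeds `p₀`. -/
theorem stmt1 {d m : ℕ} (U : Set (EuclideanSpace ℝ (Fin d)))
    (hUne : U.Nonempty) (hUb : Bornology.IsBounded U) (hUconn : IsConnected U)
    (hUopen : IsOpen U)
    (a : Fin m → EuclideanSpace ℝ (Fin d)) (ha : ∀ i, a i ∈ U)
    (r b c : ℝ) (hr : 0 < r) (hb : 0 < b) (hc : 0 < c)
    (ε pr : ℝ) (hε : ε ∈ Set.Ioo (0 : ℝ) 1) (hpr : pr ∈ Set.Ioc (0 : ℝ) 1)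
    (hmin : ∀ x ∈ U, ENNReal.ofReal pr ≤
      unifMeasure U {s' | ε * r ≤ dist x s' ∧ dist x s' ≤ r}) :
    (∃ N : ℕ, ∀ n : ℕ, n > N →
      ENNReal.ofReal (1 - (n : ℝ) * (Nat.sqrt n : ℝ)
          * ((n - 1).choose (Nat.sqrt n - 1) : ℝ) * (1 - pr) ^ (n - Nat.sqrt n)) ≤
        Measure.pi (fun _ : Fin n => unifMeasure U)
          {S | ¬ ConvexOn ℝ Set.univ (udLoss a r b c S)})
    ∧ (∀ p₀ : ℝ, p₀ < 1 → ∃ N : ℕ, ∀ n : ℕ, n > N →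
      ENNReal.ofReal p₀ <
        Measure.pi (fun _ : Fin n => unifMeasure U)
          {S | ¬ ConvexOn ℝ Set.univ (udLoss a r b c S)}) := by
  have hprob := isProbabilityMeasure_unifMeasure hUne hUb hUopen
  have hbound : ∃ N : ℕ, ∀ n : ℕ, n > N →
      ENNReal.ofReal (1 - (n : ℝ) * (Nat.sqrt n : ℝ)
          * ((n - 1).choose (Nat.sqrt n - 1) : ℝ) * (1 - pr) ^ (n - Nat.sqrt n)) ≤
        Measure.pi (fun _ : Fin n => unifMeasure U)
          {S | ¬ ConvexOn ℝ Set.univ (udLoss a r b c S)} := by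
    obtain ⟨R, hR⟩ := hUb.exists_norm_le
    have hR0 : 0 ≤ R := hUne.elim fun x hx => (norm_nonneg x).trans (hR x hx)
    have hρ : 0 < ε * r := mul_pos hε.1 hr
    have hK : 0 < ((ε * r) ^ b) ^ c := by positivity
    obtain ⟨M, hM⟩ := exists_nat_gt (m * ((2 * R) ^ b) ^ c / ((ε * r) ^ b) ^ c)
    refine ⟨M * M, fun n hn => ?_⟩
    have hn0 : 0 < n := by omega
    obtain ⟨k, rfl⟩ : ∃ k, n = k + 1 := ⟨n - 1, by omega⟩
    have hMv : M ≤ Nat.sqrt (k + 1) := Nat.le_sqrt.2 (by omega)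
    have hv0 : 0 < Nat.sqrt (k + 1) := Nat.sqrt_pos.2 hn0
    have hvn : Nat.sqrt (k + 1) ≤ k + 1 := Nat.sqrt_le_self _
    generalize Nat.sqrt (k + 1) = v at hMv hv0 hvn ⊢
    obtain ⟨s, rfl⟩ : ∃ s, v = s + 1 := ⟨v - 1, by omega⟩
    have hv : m * ((2 * R) ^ b) ^ c < (s + 1 : ℕ) * ((ε * r) ^ b) ^ c := by
      rw [div_lt_iff₀ hK] at hM
      refine hM.trans_le (mul_le_mul_of_nonneg_right ?_ hK.le)
      exact_mod_cast hMv
    set μ := unifMeasure U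
    set ann : EuclideanSpace ℝ (Fin d) → EuclideanSpace ℝ (Fin d) → Prop :=
      fun x y => ε * r ≤ dist x y ∧ dist x y ≤ r with hann
    have hannmeas : MeasurableSet {p : EuclideanSpace ℝ (Fin d) × EuclideanSpace ℝ (Fin d) |
        ann p.1 p.2} :=
      (measurableSet_le measurable_const measurable_dist).inter
        (measurableSet_le measurable_dist measurable_const)
    have hq : ∀ x ∈ U, μ {y | ¬ ann x y} ≤ ENNReal.ofReal (1 - pr) := fun x hx => by
      have hmeas : MeasurableSet {y | ann x y} :=
        (by fun_prop : Measurable fun y => (x, y)) hannmeas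
      change μ {y | ann x y}ᶜ ≤ _
      rw [prob_compl_eq_one_sub hmeas, ENNReal.ofReal_sub _ hpr.1.le, ENNReal.ofReal_one]
      exact tsub_le_tsub_left (hmin x hx) 1
    set few : Fin (k + 1) → Set (Fin (k + 1) → EuclideanSpace ℝ (Fin d)) := fun i =>
      {S | S i ∈ U ∧ (Finset.univ.filter fun j => ann (S i) (S (i.succAbove j))).card ≤ s}
    have hcover : (Set.univ : Set (Fin (k + 1) → EuclideanSpace ℝ (Fin d))) ⊆
        {S | ¬ ConvexOn ℝ Set.univ (udLoss a r b c S)} ∪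
          ({S | ∀ i, S i ∈ U}ᶜ ∪ ⋃ i, few i) := by
      intro S _
      by_contra hS
      simp only [Set.mem_union, not_or, Set.mem_compl_iff, not_not, Set.mem_iUnion, not_exists,
        Set.mem_ofPred_eq] at hS
      obtain ⟨hconv, hSU, hmany⟩ := hS
      refine not_convexOn_udLoss a hb hc hρ hR0 hn0 S (fun i => hR _ (ha i))
        (fun j => hR _ (hSU j)) (fun i => ?_) hv hconv
      have hi : s < (Finset.univ.filter fun j => ann (S i) (S (i.succAbove j))).card :=
        not_le.1 fun h => hmany i ⟨hSU i, h⟩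
      refine (Nat.succ_le_of_lt hi).trans
        (Finset.card_le_card_of_injOn i.succAbove (fun j hj => ?_)
          i.succAbove_right_injective.injOn)
      simpa [hann] using hj
    have hout : Measure.pi (fun _ : Fin (k + 1) => μ) {S | ∀ i, S i ∈ U}ᶜ = 0 := by
      have : ∀ᵐ S ∂Measure.pi (fun _ : Fin (k + 1) => μ), ∀ i, S i ∈ U :=
        ae_all_iff.2 fun i =>
          (Measure.tendsto_eval_ae_ae (i := i)).eventually (ae_mem_unifMeasure hUopen)
      exact this
    have hq0 : 0 ≤ 1 - pr := by linarith [hpr.2]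
    have hfewle : Measure.pi (fun _ : Fin (k + 1) => μ) (⋃ i, few i) ≤
        ENNReal.ofReal (((k + 1 : ℕ) : ℝ) * ((s + 1 : ℕ) : ℝ)
          * (k.choose s : ℝ) * (1 - pr) ^ (k - s)) := by
      calc _ ≤ ∑ i, Measure.pi (fun _ : Fin (k + 1) => μ) (few i) :=
            measure_iUnion_fintype_le _ _
        _ ≤ ∑ _i : Fin (k + 1), (k.choose s : ENNReal) * ENNReal.ofReal (1 - pr) ^ (k - s) :=
            Finset.sum_le_sum fun i _ =>
              measure_pi_card_le μ hannmeas hUopen.measurableSet hq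
                (Nat.le_of_succ_le_succ hvn) i
        _ = ENNReal.ofReal (((k + 1 : ℕ) : ℝ) * ((k.choose s : ℝ) * (1 - pr) ^ (k - s))) := by
            rw [ENNReal.ofReal_mul (by positivity), ENNReal.ofReal_mul (by positivity),
              ENNReal.ofReal_pow hq0, ENNReal.ofReal_natCast, ENNReal.ofReal_natCast]
            simp
        _ ≤ _ := by
            refine ENNReal.ofReal_le_ofReal ?_
            have hX : 0 ≤ ((k + 1 : ℕ) : ℝ) * ((k.choose s : ℝ) * (1 - pr) ^ (k - s)) := by
              positivity
            have hs1 : (1 : ℝ) ≤ ((s + 1 : ℕ) : ℝ) := by exact_mod_cast hv0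
            nlinarith [mul_le_mul_of_nonneg_right hs1 hX]
    have htotal := (measure_mono hcover).trans
      (measure_union_le (μ := Measure.pi (fun _ : Fin (k + 1) => μ)) _ _)
    have hbad := (measure_union_le (μ := Measure.pi (fun _ : Fin (k + 1) => μ))
      {S | ∀ i, S i ∈ U}ᶜ (⋃ i, few i)).trans (add_le_add hout.le hfewle)
    rw [zero_add] at hbad
    rw [measure_univ] at htotal
    simp only [Nat.add_sub_cancel, Nat.add_sub_add_right]
    rw [ENNReal.ofReal_sub _ (by positivity), ENNReal.ofReal_one]
    exact tsub_le_iff_right.2 (htotal.trans (add_le_add le_rfl hbad))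
  refine ⟨hbound, fun p₀ hp₀ => ?_⟩
  obtain ⟨N, hN⟩ := hbound
  have hlim := tendsto_sqrt_choose_mul_pow (q := 1 - pr) (by linarith [hpr.2])
    (by linarith [hpr.1])
  obtain ⟨N', hN'⟩ := Filter.eventually_atTop.1
    (hlim.eventually_lt_const (lt_min one_pos (sub_pos.2 hp₀)))
  refine ⟨max N N', fun n hn => lt_of_lt_of_le ?_ (hN n ((le_max_left _ _).trans_lt hn))⟩
  have hsmall := lt_min_iff.1 (hN' n ((le_max_right _ _).trans hn.le))
  exact (ENNReal.ofReal_lt_ofReal_iff (by linarith [hsmall.1])).2 (by linarith [hsmall.2])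
end

section
/- Let h > 0 and define f : ℝ² → ℝ by f(x, y) = |x² + (y−h)² − h²| + |x² + (y+h)² − h²|. Then f(x, y) = max{ 2x² + 2y², 4hy, −4hy } for all (x, y) ∈ ℝ², and consequently f is a convex function on ℝ². -/
theorem abs_sub_add_abs_add_eq_max {a : ℝ} (ha : 0 ≤ a) (b : ℝ) :
    |a - b| + |a + b| = max (max (2 * a) (2 * b)) (-(2 * b)) := by
  grind

theorem convexOn_max_two_mul_sq_add_sq (c : ℝ) :
    ConvexOn ℝ Set.univ (fun p : ℝ × ℝ =>
      max (max (2 * p.1 ^ 2 + 2 * p.2 ^ 2) (c * p.2)) (-(c * p.2))) := by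
  have hsq : ConvexOn ℝ Set.univ (fun t : ℝ => t ^ 2) := even_two.convexOn_pow
  have hfst := (hsq.comp_linearMap (LinearMap.fst ℝ ℝ ℝ)).smul (zero_le_two (α := ℝ))
  have hsnd := (hsq.comp_linearMap (LinearMap.snd ℝ ℝ ℝ)).smul (zero_le_two (α := ℝ))
  have hlin (d : ℝ) := (d • LinearMap.snd ℝ ℝ ℝ).convexOn (convex_univ (𝕜 := ℝ))
  refine (((hfst.add hsnd).sup (hlin c)).sup (hlin (-c))).congr fun p _ => ?_
  simp

/-- The function `f(x,y) = |x² + (y−h)² − h²| + |x² + (y+h)² − h²|` equals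
`max{2x² + 2y², 4hy, −4hy}` and is therefore convex on `ℝ²`. -/
theorem stmt8 (h : ℝ) (hh : 0 < h) :
    (∀ x y : ℝ, |x ^ 2 + (y - h) ^ 2 - h ^ 2| + |x ^ 2 + (y + h) ^ 2 - h ^ 2|
        = max (max (2 * x ^ 2 + 2 * y ^ 2) (4 * h * y)) (-(4 * h * y)))
    ∧ ConvexOn ℝ Set.univ (fun p : ℝ × ℝ =>
        |p.1 ^ 2 + (p.2 - h) ^ 2 - h ^ 2| + |p.1 ^ 2 + (p.2 + h) ^ 2 - h ^ 2|) := by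
  have key (x y : ℝ) : |x ^ 2 + (y - h) ^ 2 - h ^ 2| + |x ^ 2 + (y + h) ^ 2 - h ^ 2|
      = max (max (2 * x ^ 2 + 2 * y ^ 2) (4 * h * y)) (-(4 * h * y)) := by
    convert abs_sub_add_abs_add_eq_max (by positivity : 0 ≤ x ^ 2 + y ^ 2) (2 * h * y) using 3 <;>
      ring
  refine ⟨key, ?_⟩
  simp only [key]
  exact convexOn_max_two_mul_sq_add_sq (4 * h)
end

section
/- Let e > 0 and h > 0, and define F₀ : ℝ² × ℝ² → ℝ by F₀(x₁, x₂) = | ‖x₁ − (−e, h)‖² − h² | + | ‖x₁ − (−e, −h)‖² − h² | + | ‖x₂ − (e, h)‖² − h² | + | ‖x₂ − (e, −h)‖² − h² |. Then F₀ is a convex function on ℝ² × ℝ². (This is the SNL loss function, with inside degree 2 and outside degree 1, of the framework with anchors (−e, h), (−e, −h), (e, h), (e, −h), sensors s₁ = (−e, 0), s₂ = (e, 0), and edges {a₁,s₁}, {a₂,s₁}, {a₃,s₂}, {a₄,s₂}.) -/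
/-- The point `(u, v) ∈ ℝ²` as an element of Euclidean space. -/
noncomputable def pt2 (u v : ℝ) : EuclideanSpace ℝ (Fin 2) :=
  (WithLp.equiv 2 (Fin 2 → ℝ)).symm ![u, v]

/-- The four-edge SNL loss function (inside degree 2, outside degree 1) of the framework
with anchors `(−e, h)`, `(−e, −h)`, `(e, h)`, `(e, −h)`, sensors `s₁ = (−e, 0)`,
`s₂ = (e, 0)`, and edges `{a₁,s₁}, {a₂,s₁}, {a₃,s₂}, {a₄,s₂}`. -/
noncomputable def F₀ (e h : ℝ)
    (x : EuclideanSpace ℝ (Fin 2) × EuclideanSpace ℝ (Fin 2)) : ℝ :=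
  |‖x.1 - pt2 (-e) h‖ ^ 2 - h ^ 2| + |‖x.1 - pt2 (-e) (-h)‖ ^ 2 - h ^ 2|
    + |‖x.2 - pt2 e h‖ ^ 2 - h ^ 2| + |‖x.2 - pt2 e (-h)‖ ^ 2 - h ^ 2|

theorem abs_sub_add_abs_add_eq_two_mul_max (a b : ℝ) :
    |a - b| + |a + b| = 2 * max |a| |b| := by
  grind

section TwoAnchors

variable {E : Type*} [NormedAddCommGroup E] [InnerProductSpace ℝ E]

/-- The loss of two anchors `c + v` and `c - v`, both at distance `‖v‖` from the sensor `c`. -/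
theorem abs_norm_sq_sub_add_abs_norm_sq_sub_eq_max (c v x : E) :
    |‖x - (c + v)‖ ^ 2 - ‖v‖ ^ 2| + |‖x - (c - v)‖ ^ 2 - ‖v‖ ^ 2|
      = 2 * max (‖x - c‖ ^ 2) |2 * inner ℝ v (x - c)| := by
  have hplus : ‖x - (c + v)‖ ^ 2 - ‖v‖ ^ 2 = ‖x - c‖ ^ 2 - 2 * inner ℝ v (x - c) := by
    rw [← sub_sub, norm_sub_sq_real, real_inner_comm]
    ring
  have hminus : ‖x - (c - v)‖ ^ 2 - ‖v‖ ^ 2 = ‖x - c‖ ^ 2 + 2 * inner ℝ v (x - c) := by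
    rw [← sub_add, norm_add_sq_real, real_inner_comm]
    ring
  rw [hplus, hminus, abs_sub_add_abs_add_eq_two_mul_max, abs_of_nonneg (sq_nonneg ‖x - c‖)]

theorem convexOn_abs_norm_sq_sub_add_abs_norm_sq_sub (c v : E) :
    ConvexOn ℝ Set.univ fun x : E ↦
      |‖x - (c + v)‖ ^ 2 - ‖v‖ ^ 2| + |‖x - (c - v)‖ ^ 2 - ‖v‖ ^ 2| := by
  simp only [abs_norm_sq_sub_add_abs_norm_sq_sub_eq_max]
  have hsq : ConvexOn ℝ Set.univ fun y : E ↦ ‖y‖ ^ 2 :=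
    convexOn_univ_norm.pow (fun _ _ ↦ norm_nonneg _) 2
  have habs : ConvexOn ℝ Set.univ fun y : E ↦ |2 * inner ℝ v y| := by
    simpa [Function.comp_def] using
      (convexOn_univ_norm (E := ℝ)).comp_linearMap ((2 : ℝ) • (innerₛₗ ℝ v))
  have hmax := ((hsq.sup habs).smul (zero_le_two (α := ℝ))).translate_left (-c)
  simpa [Function.comp_def, sub_eq_add_neg] using hmax

end TwoAnchors

theorem norm_pt2_zero_left (h : ℝ) : ‖pt2 0 h‖ = |h| := by
  simp [pt2, EuclideanSpace.norm_eq, Real.sqrt_sq_eq_abs]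

theorem pt2_zero_right_add (u h : ℝ) : pt2 u 0 + pt2 0 h = pt2 u h := by
  ext i
  fin_cases i <;> simp [pt2]

theorem pt2_zero_right_sub (u h : ℝ) : pt2 u 0 - pt2 0 h = pt2 u (-h) := by
  ext i
  fin_cases i <;> simp [pt2]

theorem convexOn_two_anchor_loss (u h : ℝ) :
    ConvexOn ℝ Set.univ fun x : EuclideanSpace ℝ (Fin 2) ↦
      |‖x - pt2 u h‖ ^ 2 - h ^ 2| + |‖x - pt2 u (-h)‖ ^ 2 - h ^ 2| := by
  simpa only [pt2_zero_right_add, pt2_zero_right_sub, norm_pt2_zero_left, sq_abs] using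
    convexOn_abs_norm_sq_sub_add_abs_norm_sq_sub (pt2 u 0) (pt2 0 h)

/-- The four-edge loss function `F₀` is convex on `ℝ² × ℝ²`. -/
theorem stmt9 (e h : ℝ) (he : 0 < e) (hh : 0 < h) :
    ConvexOn ℝ Set.univ (F₀ e h) := by
  have hfst := (convexOn_two_anchor_loss (-e) h).comp_linearMap
    (LinearMap.fst ℝ (EuclideanSpace ℝ (Fin 2)) (EuclideanSpace ℝ (Fin 2)))
  have hsnd := (convexOn_two_anchor_loss e h).comp_linearMap
    (LinearMap.snd ℝ (EuclideanSpace ℝ (Fin 2)) (EuclideanSpace ℝ (Fin 2)))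
  refine (hfst.add hsnd).congr fun x _ ↦ ?_
  simp [F₀, add_assoc]
end

section
/- Let e > 0 and h be reals with √2·e < h < 2e, and define F : ℝ² × ℝ² → ℝ by F(x₁, x₂) = | ‖x₁ − (−e, h)‖² − h² | + | ‖x₁ − (−e, −h)‖² − h² | + | ‖x₂ − (e, h)‖² − h² | + | ‖x₂ − (e, −h)‖² − h² | + | ‖x₁ − x₂‖² − 4e² |. Then F((−e, h), (e, h)) + F((e, h), (−e, h)) < 2·F((0, h), (0, h)), and consequently F is not convex. (Thus adding the extra sensor–sensor edge {s₁, s₂} to the four-edge framework destroys the convexity of the loss function: more edges do not imply better convexity.) -/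
/-- The five-edge SNL loss function (inside degree 2, outside degree 1) of the framework
with anchors `(−e, h)`, `(−e, −h)`, `(e, h)`, `(e, −h)`, sensors `s₁ = (−e, 0)`,
`s₂ = (e, 0)`, anchor–sensor edges `{a₁,s₁}, {a₂,s₁}, {a₃,s₂}, {a₄,s₂}` and the
sensor–sensor edge `{s₁,s₂}`. -/
noncomputable def F₅ (e h : ℝ)
    (x : EuclideanSpace ℝ (Fin 2) × EuclideanSpace ℝ (Fin 2)) : ℝ :=
  |‖x.1 - pt2 (-e) h‖ ^ 2 - h ^ 2| + |‖x.1 - pt2 (-e) (-h)‖ ^ 2 - h ^ 2|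
    + |‖x.2 - pt2 e h‖ ^ 2 - h ^ 2| + |‖x.2 - pt2 e (-h)‖ ^ 2 - h ^ 2|
    + |‖x.1 - x.2‖ ^ 2 - 4 * e ^ 2|

theorem norm_pt2_sub_sq (a b c d : ℝ) :
    ‖pt2 a b - pt2 c d‖ ^ 2 = (a - c) ^ 2 + (b - d) ^ 2 := by
  simp [pt2, EuclideanSpace.norm_sq_eq, Fin.sum_univ_two]

/-- The five-edge loss at a pair of points of the line of height `h` through the upper anchors. -/
theorem F₅_pt2_height (e h u v : ℝ) :
    F₅ e h (pt2 u h, pt2 v h) =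
      |(u + e) ^ 2 - h ^ 2| + ((u + e) ^ 2 + 3 * h ^ 2)
        + |(v - e) ^ 2 - h ^ 2| + ((v - e) ^ 2 + 3 * h ^ 2)
        + |(u - v) ^ 2 - 4 * e ^ 2| := by
  have lower (w : ℝ) : |w ^ 2 + (h - -h) ^ 2 - h ^ 2| = w ^ 2 + 3 * h ^ 2 := by
    rw [show w ^ 2 + (h - -h) ^ 2 - h ^ 2 = w ^ 2 + 3 * h ^ 2 by ring]
    exact abs_of_nonneg (by positivity)
  simp only [F₅, norm_pt2_sub_sq, lower, sub_self, sub_neg_eq_add u e]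
  simp

theorem midpoint_pt2_swap (e h : ℝ) :
    midpoint ℝ (pt2 (-e) h, pt2 e h) (pt2 e h, pt2 (-e) h) = (pt2 0 h, pt2 0 h) := by
  rw [midpoint_eq_smul_add]
  ext i <;> fin_cases i <;> simp [pt2, ← two_mul]

/-- Adding the sensor–sensor edge destroys convexity: midpoint convexity of `F` fails
at the configurations `((−e,h),(e,h))`, `((e,h),(−e,h))` with midpoint `((0,h),(0,h))`,
hence `F` is not convex. -/
theorem stmt10 (e h : ℝ) (he : 0 < e) (h1 : Real.sqrt 2 * e < h) (h2 : h < 2 * e) :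
    F₅ e h (pt2 (-e) h, pt2 e h) + F₅ e h (pt2 e h, pt2 (-e) h)
        < 2 * F₅ e h (pt2 0 h, pt2 0 h)
    ∧ ¬ ConvexOn ℝ Set.univ (F₅ e h) := by
  have hlt : F₅ e h (pt2 (-e) h, pt2 e h) + F₅ e h (pt2 e h, pt2 (-e) h)
      < 2 * F₅ e h (pt2 0 h, pt2 0 h) := by
    have lower : 2 * e ^ 2 < h ^ 2 := by
      have := pow_lt_pow_left₀ h1 (by positivity) two_ne_zero
      rwa [mul_pow, Real.sq_sqrt zero_le_two] at this
    have hpos : 0 < h := lt_of_le_of_lt (by positivity) h1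
    have upper : h ^ 2 < 4 * e ^ 2 := by nlinarith
    have outer : |(e + e) ^ 2 - h ^ 2| = 4 * e ^ 2 - h ^ 2 := by
      rw [abs_of_pos] <;> linarith [show (e + e) ^ 2 = 4 * e ^ 2 by ring]
    have outer_neg : |(-e - e) ^ 2 - h ^ 2| = 4 * e ^ 2 - h ^ 2 := by
      rw [abs_of_pos] <;> linarith [show (-e - e) ^ 2 = 4 * e ^ 2 by ring]
    have inner : |e ^ 2 - h ^ 2| = h ^ 2 - e ^ 2 := by
      rw [abs_of_neg] <;> linarith [sq_nonneg e]
    have edge : (-e - e) ^ 2 - 4 * e ^ 2 = 0 := by ring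
    have edge_swap : (e - -e) ^ 2 - 4 * e ^ 2 = 0 := by ring
    have height : |(0 : ℝ) ^ 2 - h ^ 2| = h ^ 2 := by simp
    have middle : |(0 : ℝ) ^ 2 - 4 * e ^ 2| = 4 * e ^ 2 := by simp
    simp only [F₅_pt2_height, neg_add_cancel, sub_self, zero_add, zero_sub e, neg_sq,
      outer, outer_neg, inner, edge, edge_swap, height, middle, abs_zero]
    nlinarith
  refine ⟨hlt, fun hconv => ?_⟩
  have hmid := hconv.2 (Set.mem_univ (pt2 (-e) h, pt2 e h)) (Set.mem_univ (pt2 e h, pt2 (-e) h))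
    (by norm_num : (0 : ℝ) ≤ 2⁻¹) (by norm_num : (0 : ℝ) ≤ 2⁻¹) (by norm_num)
  rw [← smul_add, ← invOf_eq_inv, ← midpoint_eq_smul_add, midpoint_pt2_swap, invOf_eq_inv,
    smul_eq_mul, smul_eq_mul] at hmid
  linarith
end

section
/- Let the anchors a_1,…,a_m ∈ ℝ² all lie on the x-axis, let s = (s_1,…,s_n) ∈ (ℝ²)^n be sensor positions, let N_x, N_a be edge sets, and let b, c > 0. Let σ : ℝ² → ℝ² be the reflection σ(u, v) = (u, −v), acting componentwise on configurations. Assume: (i) σs ≠ s; and (ii) the framework is locally rigid at s, i.e., there is an open neighborhood V of s in (ℝ²)^n such that s is the unique point x ∈ V satisfying ‖x_i − x_j‖ = ‖s_i − s_j‖ for all {i,j} ∈ N_x and ‖a_i − x_j‖ = ‖a_i − s_j‖ for all (i,j) ∈ N_a. For any anchor configuration a′ = (a′_1,…,a′_m) ∈ (ℝ²)^m, let loss_{a′}(x) = Σ_{{i,j}∈N_x} | ‖x_i−x_j‖^b − ‖s_i−s_j‖^b |^c + Σ_{(i,j)∈N_a} | ‖a′_i−x_j‖^b − ‖a′_i−s_j‖^b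 |^c. Then there exists δ > 0 such that for every anchor configuration a′ with ‖a′_i − a_i‖ < δ for all i, the function loss_{a′} : (ℝ²)^n → ℝ possesses at least two distinct local minimizers. -/
/-- Reflection of `ℝ²` with respect to the x-axis. -/
noncomputable def reflX (u : EuclideanSpace ℝ (Fin 2)) : EuclideanSpace ℝ (Fin 2) :=
  pt2 (u 0) (-(u 1))

/-- The SNL loss function (inside degree `b`, outside degree `c`) of the framework with
sensors `s` and perturbed anchors `a'` (the distances are those generated by `(a', s)`). -/
noncomputable def lossPert {n m : ℕ}
    (Nx : Finset (Fin n × Fin n)) (Na : Finset (Fin m × Fin n))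
    (s : Fin n → EuclideanSpace ℝ (Fin 2)) (b c : ℝ)
    (a' : Fin m → EuclideanSpace ℝ (Fin 2))
    (x : Fin n → EuclideanSpace ℝ (Fin 2)) : ℝ :=
  ∑ p ∈ Nx, |‖x p.1 - x p.2‖ ^ b - ‖s p.1 - s p.2‖ ^ b| ^ c
    + ∑ p ∈ Na, |‖a' p.1 - x p.2‖ ^ b - ‖a' p.1 - s p.2‖ ^ b| ^ c

lemma reflX_reflX (u : EuclideanSpace ℝ (Fin 2)) : reflX (reflX u) = u := by
  ext i
  fin_cases i <;> simp [reflX, pt2]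

lemma norm_reflX_sub_reflX (u v : EuclideanSpace ℝ (Fin 2)) :
    ‖reflX u - reflX v‖ = ‖u - v‖ := by
  simp only [EuclideanSpace.norm_eq, Fin.sum_univ_two, Real.norm_eq_abs, sq_abs]
  congr 1
  simp [reflX, pt2]
  ring

lemma reflX_eq_self {u : EuclideanSpace ℝ (Fin 2)} (hu : u 1 = 0) : reflX u = u := by
  ext i
  fin_cases i <;> simp [reflX, pt2, hu]

lemma continuous_reflX : Continuous reflX :=
  (LipschitzWith.of_dist_le_mul (K := 1) fun u v => by
    simp [dist_eq_norm, norm_reflX_sub_reflX]).continuous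

section lossPert

variable {n m : ℕ} (Nx : Finset (Fin n × Fin n)) (Na : Finset (Fin m × Fin n))
  (s : Fin n → EuclideanSpace ℝ (Fin 2)) {b c : ℝ}

lemma lossPert_nonneg (a' : Fin m → EuclideanSpace ℝ (Fin 2))
    (x : Fin n → EuclideanSpace ℝ (Fin 2)) : 0 ≤ lossPert Nx Na s b c a' x := by
  unfold lossPert
  positivity

lemma continuous_lossPert (hb : 0 < b) (hc : 0 < c) :
    Continuous fun q : (Fin m → EuclideanSpace ℝ (Fin 2)) × (Fin n → EuclideanSpace ℝ (Fin 2)) =>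
      lossPert Nx Na s b c q.1 q.2 := by
  unfold lossPert
  refine .add (continuous_finsetSum _ fun p _ => ?_) (continuous_finsetSum _ fun p _ => ?_)
  · refine .rpow_const (.abs (.sub (.rpow_const (by fun_prop) ?_) (.rpow_const (by fun_prop) ?_))) ?_
      <;> intro _ <;> right <;> positivity
  · refine .rpow_const (.abs (.sub (.rpow_const (by fun_prop) ?_) (.rpow_const (by fun_prop) ?_))) ?_
      <;> intro _ <;> right <;> positivity

lemma abs_rpow_sub_rpow_rpow_eq_zero_iff (hb : 0 < b) (hc : 0 < c) {u v : ℝ}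
    (hu : 0 ≤ u) (hv : 0 ≤ v) : |u ^ b - v ^ b| ^ c = 0 ↔ u = v := by
  rw [Real.rpow_eq_zero (abs_nonneg _) hc.ne', abs_eq_zero, sub_eq_zero,
    Real.rpow_left_inj hu hv hb.ne']

/-- The zeros of the loss are exactly the configurations realizing all prescribed distances. -/
lemma lossPert_eq_zero_iff (hb : 0 < b) (hc : 0 < c) (a' : Fin m → EuclideanSpace ℝ (Fin 2))
    (x : Fin n → EuclideanSpace ℝ (Fin 2)) :
    lossPert Nx Na s b c a' x = 0 ↔
      (∀ p ∈ Nx, ‖x p.1 - x p.2‖ = ‖s p.1 - s p.2‖) ∧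
        ∀ p ∈ Na, ‖a' p.1 - x p.2‖ = ‖a' p.1 - s p.2‖ := by
  unfold lossPert
  rw [add_eq_zero_iff_of_nonneg (by positivity) (by positivity),
    Finset.sum_eq_zero_iff_of_nonneg (fun _ _ => by positivity),
    Finset.sum_eq_zero_iff_of_nonneg (fun _ _ => by positivity)]
  simp only [abs_rpow_sub_rpow_rpow_eq_zero_iff hb hc (norm_nonneg _) (norm_nonneg _)]

lemma isLocalMin_lossPert_self (hb : 0 < b) (hc : 0 < c)
    (a' : Fin m → EuclideanSpace ℝ (Fin 2)) : IsLocalMin (lossPert Nx Na s b c a') s := by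
  refine Filter.Eventually.of_forall fun x => ?_
  rw [(lossPert_eq_zero_iff Nx Na s hb hc a' s).2 ⟨fun _ _ => rfl, fun _ _ => rfl⟩]
  exact lossPert_nonneg Nx Na s a' x

/-- With anchors on the x-axis, reflecting the sensors does not change the loss. -/
lemma lossPert_reflX {a : Fin m → EuclideanSpace ℝ (Fin 2)} (hax : ∀ i, a i 1 = 0)
    (x : Fin n → EuclideanSpace ℝ (Fin 2)) :
    lossPert Nx Na s b c a (fun i => reflX (x i)) = lossPert Nx Na s b c a x := by
  have ha : ∀ i u, ‖a i - reflX u‖ = ‖a i - u‖ := fun i u => by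
    rw [← norm_reflX_sub_reflX (a i) u, reflX_eq_self (hax i)]
  simp only [lossPert, norm_reflX_sub_reflX, ha]

end lossPert

/-- A strict minimum over a sphere persists, as a local minimum inside the ball, under small
changes of the parameter. -/
lemma eventually_exists_isLocalMin_mem_ball {A X : Type*} [TopologicalSpace A]
    [PseudoMetricSpace X] [ProperSpace X] {F : A → X → ℝ}
    (hF : Continuous fun q : A × X => F q.1 q.2) {a : A} {t : X} {r : ℝ} (hr : 0 < r)
    (hlt : ∀ x ∈ Metric.sphere t r, F a t < F a x) :
    ∀ᶠ a' in nhds a, ∃ y ∈ Metric.ball t r, IsLocalMin (F a') y := by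
  have hev : ∀ᶠ a' in nhds a, ∀ x ∈ Metric.sphere t r, F a' t < F a' x := by
    refine (isCompact_sphere t r).eventually_forall_of_forall_eventually fun x hx => ?_
    exact (isOpen_lt (hF.comp (continuous_fst.prodMk continuous_const)) hF).mem_nhds (hlt x hx)
  filter_upwards [hev] with a' ha'
  refine (isCompact_closedBall t r).exists_isLocalMin_mem_open Metric.ball_subset_closedBall
    (hF.comp (.prodMk_right a')).continuousOn (Metric.mem_closedBall_self hr.le)
    (fun x hx => ha' x ?_) Metric.isOpen_ball
  rwa [Metric.closedBall_sdiff_ball] at hx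

/-- A locally rigid 2-dimensional framework with colinear anchors and a sensor
configuration not fixed by the reflection: after any sufficiently small perturbation of
the anchors, the loss function still has at least two distinct local minimizers. -/
theorem stmt12 {n m : ℕ} (hn : 1 ≤ n) (hm : 1 ≤ m)
    (a : Fin m → EuclideanSpace ℝ (Fin 2)) (hax : ∀ i, a i 1 = 0)
    (s : Fin n → EuclideanSpace ℝ (Fin 2))
    (Nx : Finset (Fin n × Fin n)) (Na : Finset (Fin m × Fin n))
    (b c : ℝ) (hb : 0 < b) (hc : 0 < c)
    (hmirror : (fun i => reflX (s i)) ≠ s)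
    (hrigid : ∃ V : Set (Fin n → EuclideanSpace ℝ (Fin 2)), IsOpen V ∧ s ∈ V ∧
      ∀ x ∈ V, ((∀ p ∈ Nx, ‖x p.1 - x p.2‖ = ‖s p.1 - s p.2‖) ∧
        (∀ p ∈ Na, ‖a p.1 - x p.2‖ = ‖a p.1 - s p.2‖)) → x = s) :
    ∃ δ > (0 : ℝ), ∀ a' : Fin m → EuclideanSpace ℝ (Fin 2),
      (∀ i, ‖a' i - a i‖ < δ) →
      ∃ y₁ y₂ : Fin n → EuclideanSpace ℝ (Fin 2), y₁ ≠ y₂ ∧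
        IsLocalMin (lossPert Nx Na s b c a') y₁ ∧
        IsLocalMin (lossPert Nx Na s b c a') y₂ := by
  set t : Fin n → EuclideanSpace ℝ (Fin 2) := fun i => reflX (s i) with ht
  obtain ⟨V, hVo, hsV, hV⟩ := hrigid
  have hR : Continuous fun (x : Fin n → EuclideanSpace ℝ (Fin 2)) i => reflX (x i) :=
    continuous_pi fun i => continuous_reflX.comp (continuous_apply i)
  have htt : (fun i => reflX (t i)) = s := funext fun i => reflX_reflX (s i)
  have hnhds : (fun (x : Fin n → EuclideanSpace ℝ (Fin 2)) i => reflX (x i)) ⁻¹' V ∩ {s}ᶜ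
      ∈ nhds t :=
    ((hVo.preimage hR).inter isOpen_compl_singleton).mem_nhds
      ⟨by rw [Set.mem_preimage, htt]; exact hsV, hmirror⟩
  obtain ⟨r, hr, hball⟩ := Metric.nhds_basis_closedBall.mem_iff.1 hnhds
  have hzero : lossPert Nx Na s b c a t = 0 := by
    rw [ht, lossPert_reflX Nx Na s hax, lossPert_eq_zero_iff Nx Na s hb hc]
    exact ⟨fun _ _ => rfl, fun _ _ => rfl⟩
  have hlt : ∀ x ∈ Metric.sphere t r, lossPert Nx Na s b c a t < lossPert Nx Na s b c a x := by
    intro x hx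
    rw [hzero]
    refine (lossPert_nonneg Nx Na s a x).lt_of_ne' fun h0 => ?_
    rw [← lossPert_reflX Nx Na s hax, lossPert_eq_zero_iff Nx Na s hb hc] at h0
    have hxs := hV _ (hball (Metric.sphere_subset_closedBall hx)).1 h0
    have hxt : x = t := funext fun i =>
      (reflX_reflX (x i)).symm.trans (congrArg reflX (congrFun hxs i))
    rw [hxt, Metric.mem_sphere, dist_self] at hx
    exact hr.ne hx
  obtain ⟨δ, hδ, hδball⟩ := Metric.eventually_nhds_iff.1
    (eventually_exists_isLocalMin_mem_ball (continuous_lossPert Nx Na s hb hc) hr hlt)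
  refine ⟨δ, hδ, fun a' ha' => ?_⟩
  obtain ⟨y, hy, hmin⟩ := hδball ((dist_pi_lt_iff hδ).2 fun i => by
    rw [dist_eq_norm]; exact ha' i)
  exact ⟨s, y, fun h => (hball (Metric.ball_subset_closedBall hy)).2 h.symm,
    isLocalMin_lossPert_self Nx Na s hb hc a', hmin⟩
end

section
/- Let f, g : ℝ^N → ℝ be continuous, let y ∈ ℝ^N and ρ > 0, let B be the closed ball of radius ρ centered at y and S its boundary sphere. Suppose f(y) < inf_{z∈S} f(z) and sup_{z∈B} |g(z) − f(z)| < (inf_{z∈S} f(z) − f(y))/2. Then g has a local minimizer in the open ball of radius ρ centered at y; i.e., there exists x* with ‖x* − y‖ < ρ such that g(x*) ≤ g(x) for all x in some neighborhood of x*. -/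
/-- Stability of local minimizers: if `f(y)` is below the infimum of `f` on the sphere
`S` of radius `ρ` around `y`, and `g` is uniformly closer to `f` on the closed ball than
half the gap, then `g` has a local minimizer in the open ball of radius `ρ` around `y`. -/
theorem stmt13 {N : ℕ} (f g : EuclideanSpace ℝ (Fin N) → ℝ)
    (hf : Continuous f) (hg : Continuous g)
    (y : EuclideanSpace ℝ (Fin N)) (ρ : ℝ) (hρ : 0 < ρ)
    (hfy : f y < sInf (f '' Metric.sphere y ρ))
    (hclose : sSup ((fun z => |g z - f z|) '' Metric.closedBall y ρ)
        < (sInf (f '' Metric.sphere y ρ) - f y) / 2) :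
    ∃ x, ‖x - y‖ < ρ ∧ IsLocalMin g x := by
  have hdist : ∀ z ∈ Metric.closedBall y ρ,
      |g z - f z| < (sInf (f '' Metric.sphere y ρ) - f y) / 2 := fun z hz =>
    (le_csSup ((isCompact_closedBall y ρ).image (by fun_prop)).bddAbove
      (Set.mem_image_of_mem _ hz)).trans_lt hclose
  have hy : y ∈ Metric.closedBall y ρ := Metric.mem_closedBall_self hρ.le
  have hsphere : ∀ z ∈ Metric.sphere y ρ, g y < g z := by
    intro z hz
    have hinf : sInf (f '' Metric.sphere y ρ) ≤ f z :=
      csInf_le ((isCompact_sphere y ρ).image hf).bddBelow (Set.mem_image_of_mem f hz)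
    have hgy := (abs_lt.mp (hdist y hy)).2
    have hgz := (abs_lt.mp (hdist z (Metric.sphere_subset_closedBall hz))).1
    linarith
  obtain ⟨x, hx, hmin⟩ := Metric.exists_isLocalMin_mem_ball hg.continuousOn hy hsphere
  exact ⟨x, mem_ball_iff_norm.mp hx, hmin⟩
end

section
/- Suppose p = (p_1,…,p_n) and q = (q_1,…,q_n), with p_i, q_i ∈ ℝ^d, are two solutions to a d-dimensional SNL problem, i.e., ‖a_i − p_j‖ = ‖a_i − q_j‖ = d̃_{ij} for all (i,j) ∈ N_a and ‖p_i − p_j‖ = ‖q_i − q_j‖ = d_{ij} for all {i,j} ∈ N_x. For t ∈ [0,1] define p_i(t) = ( (p_i + q_i)/2 + cos(πt)·(p_i − q_i)/2 , sin(πt)·(p_i − q_i)/2 ) ∈ ℝ^d × ℝ^d. Then: (1) p_i(0) = (p_i, 0) and p_i(1) = (q_i, 0) for all i; (2) for all t ∈ [0,1] and all {i,j} ∈ N_x, ‖p_i(t) − p_j(t)‖ = d_{ij}; and (3) for all t ∈ [0,1] and all (i,j) ∈ N_a, ‖(a_i, 0) − p_j(t)‖ = d̃_{ij}. Hence t ↦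 (p_1(t),…,p_n(t)) is a path joining p and q every point of which is a solution to the 2d-dimensional SNL problem obtained by padding the anchors with zeros. -/
/-- The point at parameter `t` of the path in doubled dimension joining `p` (at `t = 0`)
and `q` (at `t = 1`):
`(p+q)/2 + cos(πt)·(p−q)/2` in the first factor, `sin(πt)·(p−q)/2` in the second. -/
noncomputable def pathPt {d : ℕ} (p q : EuclideanSpace ℝ (Fin d)) (t : ℝ) :
    WithLp 2 (EuclideanSpace ℝ (Fin d) × EuclideanSpace ℝ (Fin d)) :=
  (WithLp.equiv 2 (EuclideanSpace ℝ (Fin d) × EuclideanSpace ℝ (Fin d))).symm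
    ((1 / 2 : ℝ) • (p + q) + Real.cos (Real.pi * t) • ((1 / 2 : ℝ) • (p - q)),
      Real.sin (Real.pi * t) • ((1 / 2 : ℝ) • (p - q)))

theorem pathPt_zero {d : ℕ} (p q : EuclideanSpace ℝ (Fin d)) :
    pathPt p q 0 = (WithLp.equiv 2
      (EuclideanSpace ℝ (Fin d) × EuclideanSpace ℝ (Fin d))).symm (p, 0) := by
  unfold pathPt
  congr 2
  · simp only [mul_zero, Real.cos_zero]
    module
  · simp

theorem pathPt_one {d : ℕ} (p q : EuclideanSpace ℝ (Fin d)) :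
    pathPt p q 1 = (WithLp.equiv 2
      (EuclideanSpace ℝ (Fin d) × EuclideanSpace ℝ (Fin d))).symm (q, 0) := by
  unfold pathPt
  congr 2
  · simp only [mul_one, Real.cos_pi]
    module
  · simp

theorem pathPt_self {d : ℕ} (a : EuclideanSpace ℝ (Fin d)) (t : ℝ) :
    pathPt a a t = (WithLp.equiv 2
      (EuclideanSpace ℝ (Fin d) × EuclideanSpace ℝ (Fin d))).symm (a, 0) := by
  unfold pathPt
  congr 2
  · module
  · simp

theorem pathPt_sub {d : ℕ} (p q p' q' : EuclideanSpace ℝ (Fin d)) (t : ℝ) :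
    pathPt p q t - pathPt p' q' t = pathPt (p - p') (q - q') t := by
  unfold pathPt
  simp only [WithLp.equiv_symm_apply, ← WithLp.toLp_sub, Prod.mk_sub_mk]
  congr 2 <;> module

/-- The path between two vectors of equal norm stays on the sphere through them. -/
theorem norm_pathPt {d : ℕ} {u v : EuclideanSpace ℝ (Fin d)} {r : ℝ}
    (hu : ‖u‖ = r) (hv : ‖v‖ = r) (t : ℝ) : ‖pathPt u v t‖ = r := by
  have hr : 0 ≤ r := hu ▸ norm_nonneg u
  rw [← sq_eq_sq₀ (norm_nonneg _) hr, WithLp.prod_norm_sq_eq_of_L2]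
  change ‖(1 / 2 : ℝ) • (u + v) + Real.cos (Real.pi * t) • ((1 / 2 : ℝ) • (u - v))‖ ^ 2
    + ‖Real.sin (Real.pi * t) • ((1 / 2 : ℝ) • (u - v))‖ ^ 2 = r ^ 2
  rw [← real_inner_self_eq_norm_sq, ← real_inner_self_eq_norm_sq]
  simp only [inner_add_left, inner_add_right, inner_sub_left, inner_sub_right,
    real_inner_smul_left, real_inner_smul_right]
  rw [real_inner_self_eq_norm_sq, real_inner_self_eq_norm_sq, hu, hv, real_inner_comm u v]
  linear_combination (r ^ 2 / 2 - inner ℝ u v / 2) * Real.sin_sq_add_cos_sq (Real.pi * t)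

/-- Two solutions `p`, `q` of a `d`-dimensional SNL problem are joined by a path in
dimension `2d`, every point of which is a solution of the `2d`-dimensional SNL problem
obtained by padding the anchors with zeros. -/
theorem stmt15 {d n m : ℕ}
    (Nx : Finset (Fin n × Fin n)) (Na : Finset (Fin m × Fin n))
    (a : Fin m → EuclideanSpace ℝ (Fin d))
    (dd : Fin n × Fin n → ℝ) (dt : Fin m × Fin n → ℝ)
    (hdd : ∀ e ∈ Nx, 0 < dd e) (hdt : ∀ e ∈ Na, 0 < dt e)
    (p q : Fin n → EuclideanSpace ℝ (Fin d))
    (hpa : ∀ e ∈ Na, ‖a e.1 - p e.2‖ = dt e) (hqa : ∀ e ∈ Na, ‖a e.1 - q e.2‖ = dt e)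
    (hpx : ∀ e ∈ Nx, ‖p e.1 - p e.2‖ = dd e) (hqx : ∀ e ∈ Nx, ‖q e.1 - q e.2‖ = dd e) :
    (∀ i : Fin n,
      pathPt (p i) (q i) 0 = (WithLp.equiv 2
          (EuclideanSpace ℝ (Fin d) × EuclideanSpace ℝ (Fin d))).symm (p i, 0)
      ∧ pathPt (p i) (q i) 1 = (WithLp.equiv 2
          (EuclideanSpace ℝ (Fin d) × EuclideanSpace ℝ (Fin d))).symm (q i, 0))
    ∧ (∀ t ∈ Set.Icc (0 : ℝ) 1, ∀ e ∈ Nx,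
        ‖pathPt (p e.1) (q e.1) t - pathPt (p e.2) (q e.2) t‖ = dd e)
    ∧ (∀ t ∈ Set.Icc (0 : ℝ) 1, ∀ e ∈ Na,
        ‖(WithLp.equiv 2 (EuclideanSpace ℝ (Fin d) × EuclideanSpace ℝ (Fin d))).symm
            (a e.1, 0) - pathPt (p e.2) (q e.2) t‖ = dt e) := by
  refine ⟨fun i => ⟨pathPt_zero _ _, pathPt_one _ _⟩, fun t _ e he => ?_, fun t _ e he => ?_⟩
  · rw [pathPt_sub]
    exact norm_pathPt (hpx e he) (hqx e he) t
  · rw [← pathPt_self (a e.1) t, pathPt_sub]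
    exact norm_pathPt (hpa e he) (hqa e he) t
end

section
/- Let p₁, p₂, q₁, q₂ ∈ ℝ^d satisfy ‖p₁ − p₂‖ = ‖q₁ − q₂‖, and for t ∈ ℝ and k ∈ {1,2} define γ_k(t) = ( (p_k + q_k)/2 + cos(πt)·(p_k − q_k)/2 , sin(πt)·(p_k − q_k)/2 ) ∈ ℝ^d × ℝ^d. Then ‖γ₁(t) − γ₂(t)‖ = ‖p₁ − p₂‖ for every t ∈ ℝ. -/
/-- The path point depends linearly on its endpoints. -/
lemma pathPt_sub_s17 {d : ℕ} (p₁ p₂ q₁ q₂ : EuclideanSpace ℝ (Fin d)) (t : ℝ) :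
    pathPt p₁ q₁ t - pathPt p₂ q₂ t = pathPt (p₁ - p₂) (q₁ - q₂) t := by
  simp only [pathPt, WithLp.equiv_symm_apply, ← WithLp.toLp_sub, Prod.mk_sub_mk]
  congr 2 <;> module

/-- The path joining two vectors of equal norm stays on the sphere of that radius. -/
lemma norm_pathPt_s17 {d : ℕ} {p q : EuclideanSpace ℝ (Fin d)} (h : ‖p‖ = ‖q‖) (t : ℝ) :
    ‖pathPt p q t‖ = ‖p‖ := by
  rw [← sq_eq_sq₀ (norm_nonneg _) (norm_nonneg _), WithLp.prod_norm_sq_eq_of_L2]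
  simp only [pathPt, WithLp.equiv_symm_apply, WithLp.toLp_fst, WithLp.toLp_snd]
  have horth : inner ℝ (p + q) (p - q) = 0 :=
    (real_inner_add_sub_eq_zero_iff p q).2 h
  have hpar := parallelogram_law_with_norm ℝ p q
  rw [norm_add_sq_real]
  simp only [norm_smul, inner_smul_left, inner_smul_right, horth, mul_pow, Real.norm_eq_abs,
    sq_abs, mul_zero, add_zero]
  rw [← h] at hpar
  linear_combination (1 / 4) * ‖p - q‖ ^ 2 * Real.sin_sq_add_cos_sq (Real.pi * t) +
    (1 / 4) * hpar

/-- Sensor–sensor distance preservation along the path: if `‖p₁ − p₂‖ = ‖q₁ − q₂‖`, then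
the distance between the two path points is `‖p₁ − p₂‖` for every `t`. -/
theorem stmt17 {d : ℕ} (p₁ p₂ q₁ q₂ : EuclideanSpace ℝ (Fin d))
    (hpq : ‖p₁ - p₂‖ = ‖q₁ - q₂‖) (t : ℝ) :
    ‖pathPt p₁ q₁ t - pathPt p₂ q₂ t‖ = ‖p₁ - p₂‖ := by
  rw [pathPt_sub_s17, norm_pathPt_s17 hpq]
end
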